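/- For every integer n ≥ 2 and every real t with |t| ≥ 3, the (n−1)-dimensional Lebesgue measure of G_{n−1}(t) = {(q_1,…,q_{n−1}) ∈ ℝ^{n−1} : max_i |q_i| ≤ 1 and |Σ_{k=1}^{n−1} q_k t^k| ≤ 1} equals 2^{n−1}/|t|^{n−1}. -/

import Mathlib

open MeasureTheory

/-- The domain `G_n(t) ⊆ ℝ^n`: vectors `(q_1, …, q_n)` (indexed by `i : Fin n`, where `q i`
stands for `q_{i+1}`) with `|q_i| ≤ 1` and `|∑_{k=1}^{n} q_k t^k| ≤ 1`. -/
def Gset (n : ℕ) (t : ℝ) : Set (Fin n → ℝ) :=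
  {q | (∀ i, |q i| ≤ 1) ∧ |∑ i, q i * t ^ ((i : ℕ) + 1)| ≤ 1}

lemma geo_bound (s : ℝ) (hs : 3 ≤ s) (m : ℕ) :
    1 + ∑ i : Fin m, s ^ ((i : ℕ) + 1) ≤ s ^ (m + 1) := by
  induction m with
  | zero => simp; linarith
  | succ k ih =>
    rw [Fin.sum_univ_castSucc]
    simp only [Fin.val_castSucc, Fin.val_last]
    have : 0 ≤ s ^ (k + 1) := by positivity
    rw [pow_succ s (k + 1)]
    nlinarith

/-- The lower triangular matrix `q ↦ (q_1, …, q_m, ∑ q_k t^k)`. -/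
def triMat (m : ℕ) (t : ℝ) : Matrix (Fin (m + 1)) (Fin (m + 1)) ℝ :=
  fun i j => if i = Fin.last m then t ^ ((j : ℕ) + 1) else if i = j then 1 else 0

lemma triMat_det (m : ℕ) (t : ℝ) : (triMat m t).det = t ^ (m + 1) := by
  rw [Matrix.det_of_lowerTriangular]
  · rw [Fin.prod_univ_castSucc]
    simp [triMat, Fin.castSucc_ne_last]
  · intro i j hij
    have hij' : i < j := by simpa using hij
    have h1 : i ≠ Fin.last m := fun h => by
      subst h; exact absurd (Fin.le_last j) (not_le.mpr hij')
    simp [triMat, h1, hij'.ne]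

lemma Gset_eq (m : ℕ) (t : ℝ) (ht : 3 ≤ |t|) :
    Gset (m + 1) t = (Matrix.toLin' (triMat m t)) ⁻¹' (Set.Icc (fun _ => -1) (fun _ => 1)) := by
  ext q
  have hl : (Matrix.toLin' (triMat m t)) q (Fin.last m) = ∑ i, q i * t ^ ((i : ℕ) + 1) := by
    simp [Matrix.toLin'_apply, Matrix.mulVec, dotProduct, triMat, mul_comm]
  have hc : ∀ i : Fin m, (Matrix.toLin' (triMat m t)) q i.castSucc = q i.castSucc := by
    intro i
    simp [Matrix.toLin'_apply, Matrix.mulVec, dotProduct, triMat, Fin.castSucc_ne_last]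
  have hm : q ∈ (Matrix.toLin' (triMat m t)) ⁻¹' (Set.Icc (fun _ => -1) (fun _ => 1)) ↔
      (∀ i : Fin m, |q i.castSucc| ≤ 1) ∧ |∑ i, q i * t ^ ((i : ℕ) + 1)| ≤ 1 := by
    rw [Set.mem_preimage, Set.mem_Icc, Pi.le_def, Pi.le_def, ← forall_and]
    simp only [← abs_le]
    rw [Fin.forall_fin_succ', hl]
    simp only [hc]
  rw [hm]
  constructor
  · rintro ⟨h1, h2⟩
    exact ⟨fun i => h1 _, h2⟩
  · rintro ⟨h1, h2⟩
    refine ⟨?_, h2⟩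
    rw [Fin.forall_fin_succ']
    refine ⟨h1, ?_⟩
    have hb := geo_bound |t| ht m
    rw [Fin.sum_univ_castSucc] at h2
    simp only [Fin.val_castSucc, Fin.val_last] at h2
    set S := ∑ i : Fin m, q i.castSucc * t ^ ((i : ℕ) + 1) with hS
    have hSb : |S| ≤ ∑ i : Fin m, |t| ^ ((i : ℕ) + 1) := by
      refine (Finset.abs_sum_le_sum_abs _ _).trans (Finset.sum_le_sum fun i _ => ?_)
      rw [abs_mul, abs_pow]
      exact mul_le_of_le_one_left (by positivity) (h1 i)
    have h3 : |q (Fin.last m)| * |t| ^ (m + 1) ≤ |t| ^ (m + 1) := by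
      rw [← abs_pow, ← abs_mul, abs_pow]
      have := abs_sub (S + q (Fin.last m) * t ^ (m + 1)) S
      rw [add_sub_cancel_left] at this
      linarith
    have hp : 0 < |t| ^ (m + 1) := by
      have : 0 < |t| := by linarith
      positivity
    exact le_of_mul_le_mul_right (by linarith) hp

theorem volume_Gset_of_large_t (n : ℕ) (hn : 2 ≤ n) (t : ℝ) (ht : 3 ≤ |t|) :
    volume (Gset (n - 1) t) = ENNReal.ofReal (2 ^ (n - 1) / |t| ^ (n - 1)) := by
  obtain ⟨m, hm⟩ : ∃ m, n - 1 = m + 1 := ⟨n - 2, by omega⟩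
  rw [hm, Gset_eq m t ht]
  have ht0 : t ≠ 0 := by
    rintro rfl
    norm_num at ht
  have hd : LinearMap.det (Matrix.toLin' (triMat m t)) = t ^ (m + 1) := by
    rw [LinearMap.det_toLin', triMat_det]
  rw [Measure.addHaar_preimage_linearMap _ (by rw [hd]; positivity), hd, Real.volume_Icc_pi,
    Finset.prod_const, ← ENNReal.ofReal_pow (by norm_num), ← ENNReal.ofReal_mul (by positivity)]
  congr 1
  rw [abs_inv, abs_pow, Finset.card_univ, Fintype.card_fin, div_eq_inv_mul]
  norm_num
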